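/- arXiv:1602.03253 — 2 statements merged into one kernel-verified Lean document; each statement's English description precedes it below -/
import Mathlib

section
/- Let q be a smooth, everywhere positive probability density on ℝ^d with score s_q = ∇ log q, and let k : ℝ^d × ℝ^d → ℝ have continuous second-order partial derivatives. Fix x' ∈ ℝ^d and suppose that each component of the function v(·, x') defined by v(x,x') = k(x,x') s_q(x') + ∇_{x'} k(x,x') is in the Stein class of q, and that x ↦ u_q(x,x') q(x) is integrable, where u_q(x,x') = s_q(x)ᵀ k(x,x') s_q(x') + s_q(x)ᵀ ∇_{x'}k(x,x') + ∇_x k(x,x')ᵀ s_q(x') + tr(∇_{x,x'} k(x,x')). Then ∫_{ℝ^d} u_q(x,x') q(x) dx = 0. -/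
open MeasureTheory Real
open scoped RealInnerProductSpace

noncomputable section

/-- Abbreviation for Euclidean space `ℝ^d`. -/
abbrev Eu (d : ℕ) := EuclideanSpace ℝ (Fin d)

/-- The Stein score function `s_p = ∇ₓ log p`. -/
def score {d : ℕ} (p : Eu d → ℝ) (x : Eu d) : Eu d :=
  gradient (fun y => Real.log (p y)) x

/-- `f` is in the Stein class of `p` : the map `x ↦ ∇ₓ(f x * p x)` is (Lebesgue) integrable
on `ℝ^d` and its integral vanishes (componentwise, i.e. as a vector in `ℝ^d`). -/
def SteinClass {d : ℕ} (p f : Eu d → ℝ) : Prop :=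
  MeasureTheory.Integrable (fun x => gradient (fun y => f y * p y) x) ∧
    (∫ x, gradient (fun y => f y * p y) x) = 0


/-- Gradient of a two-variable kernel in its first argument. -/
def grad1 {d : ℕ} (k : Eu d → Eu d → ℝ) (x x' : Eu d) : Eu d :=
  gradient (fun y => k y x') x

/-- Gradient of a two-variable kernel in its second argument. -/
def grad2 {d : ℕ} (k : Eu d → Eu d → ℝ) (x x' : Eu d) : Eu d :=
  gradient (fun y' => k x y') x'

/-- Trace of the matrix of mixed second partials `(∂²k/∂x_i∂x'_i)` : `tr(∇ₓ∇ₓ'k)`. -/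
def trMixed {d : ℕ} (k : Eu d → Eu d → ℝ) (x x' : Eu d) : ℝ :=
  ∑ i, fderiv ℝ (fun y => grad2 k y x' i) x (EuclideanSpace.single i 1)

/-- The Stein kernel
`u_q(x,x') = s_q(x)ᵀ k s_q(x') + s_q(x)ᵀ∇ₓ'k + ∇ₓkᵀ s_q(x') + tr(∇ₓ∇ₓ'k)`. -/
def uq {d : ℕ} (q : Eu d → ℝ) (k : Eu d → Eu d → ℝ) (x x' : Eu d) : ℝ :=
  k x x' * ⟪score q x, score q x'⟫ + ⟪score q x, grad2 k x x'⟫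
    + ⟪grad1 k x x', score q x'⟫ + trMixed k x x'


theorem gradient_apply_eq_fderiv_single {d : ℕ} (f : Eu d → ℝ) (x : Eu d) (i : Fin d) :
    gradient f x i = fderiv ℝ f x (EuclideanSpace.single i 1) := by
  have h := InnerProductSpace.toDual_symm_apply (𝕜 := ℝ)
    (x := (EuclideanSpace.single i 1 : Eu d)) (y := fderiv ℝ f x)
  rw [EuclideanSpace.inner_single_right] at h
  simpa [gradient] using h

theorem differentiable_grad2_apply {d : ℕ} {k : Eu d → Eu d → ℝ}
    (hk : ContDiff ℝ 2 (fun z : Eu d × Eu d => k z.1 z.2)) (x' : Eu d) (i : Fin d) :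
    Differentiable ℝ (fun x => grad2 k x x' i) := by
  have h : (fun x => grad2 k x x' i) = fun x =>
      fderiv ℝ (fun z : Eu d × Eu d => k z.1 z.2) (x, x') (0, EuclideanSpace.single i 1) := by
    funext x
    have hd := ((hk.differentiable (by norm_num)) (x, x')).hasFDerivAt.comp x'
      ((hasFDerivAt_const x x').prodMk (hasFDerivAt_id x'))
    have he : fderiv ℝ (fun y' => k x y') x' = _ := hd.fderiv
    rw [grad2, gradient_apply_eq_fderiv_single, he]
    simp
  rw [h]
  have hf : Differentiable ℝ (fderiv ℝ (fun z : Eu d × Eu d => k z.1 z.2)) :=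
    (hk.fderiv_right (m := 1) (by norm_num)).differentiable (by norm_num)
  exact (hf.comp (differentiable_id.prodMk (differentiable_const x'))).clm_apply
    (differentiable_const _)

theorem mul_score_apply {d : ℕ} {q : Eu d → ℝ} {x : Eu d} (hq : DifferentiableAt ℝ q x)
    (hx : q x ≠ 0) (i : Fin d) :
    q x * score q x i = fderiv ℝ q x (EuclideanSpace.single i 1) := by
  rw [score, gradient_apply_eq_fderiv_single, fderiv.log hq hx]
  simp [hx]

/-- The Stein kernel times the density is the divergence of `v(·, x') q`. -/
theorem uq_mul_eq_sum_gradient {d : ℕ} {q : Eu d → ℝ} {k : Eu d → Eu d → ℝ}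
    (hq : Differentiable ℝ q) (hq0 : ∀ x, q x ≠ 0)
    (hk : ContDiff ℝ 2 (fun z : Eu d × Eu d => k z.1 z.2)) (x x' : Eu d) :
    uq q k x x' * q x =
      ∑ i, gradient (fun y => (k y x' • score q x' + grad2 k y x') i * q y) x i := by
  have hk1 : Differentiable ℝ (fun y => k y x') :=
    (hk.differentiable (by norm_num)).comp (differentiable_id.prodMk (differentiable_const x'))
  have hterm (i : Fin d) :
      gradient (fun y => (k y x' • score q x' + grad2 k y x') i * q y) x i =
        (k x x' * (score q x i * score q x' i) + score q x i * grad2 k x x' i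
          + grad1 k x x' i * score q x' i
          + fderiv ℝ (fun y => grad2 k y x' i) x (EuclideanSpace.single i 1)) * q x := by
    have hd := (((hk1 x).hasFDerivAt.mul_const (score q x' i)).add
      (differentiable_grad2_apply hk x' i x).hasFDerivAt).mul (hq x).hasFDerivAt
    have he : fderiv ℝ (fun y => (k y x' • score q x' + grad2 k y x') i * q y) x = _ := hd.fderiv
    rw [gradient_apply_eq_fderiv_single, he, grad1, gradient_apply_eq_fderiv_single]
    simp only [Pi.add_apply, add_apply, smul_apply, smul_eq_mul,
      ← mul_score_apply (hq x) (hq0 x)]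
    ring
  simp only [hterm, ← Finset.sum_mul, Finset.sum_add_distrib, ← Finset.mul_sum]
  simp only [uq, trMixed, PiLp.inner_apply, RCLike.inner_apply, conj_trivial, mul_comm]

/-- **Stein identity for the Stein kernel.** Fix `x'`. If each component of
`v(·,x') = k(·,x') s_q(x') + ∇_{x'}k(·,x')` is in the Stein class of `q` and
`x ↦ u_q(x,x') q(x)` is integrable, then `∫ u_q(x,x') q(x) dx = 0`. -/
theorem uq_expectation_zero {d : ℕ} (q : Eu d → ℝ) (k : Eu d → Eu d → ℝ)
    (hq : ContDiff ℝ (⊤ : ℕ∞) q) (hqpos : ∀ x, 0 < q x) (hqint : (∫ x, q x) = 1)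
    (hk : ContDiff ℝ 2 (fun z : Eu d × Eu d => k z.1 z.2))
    (x' : Eu d)
    (hv : ∀ ℓ : Fin d,
      SteinClass q (fun x => (k x x' • score q x' + grad2 k x x') ℓ))
    (hint : MeasureTheory.Integrable (fun x => uq q k x x' * q x)) :
    (∫ x, uq q k x x' * q x) = 0 := by
  have happ {f : Eu d → Eu d} (hf : Integrable f) (i : Fin d) :
      Integrable (fun x => f x i) ∧ ∫ x, f x i = (∫ x, f x) i :=
    ⟨(EuclideanSpace.proj (𝕜 := ℝ) i).integrable_comp hf,
      (EuclideanSpace.proj (𝕜 := ℝ) i).integral_comp_comm hf⟩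
  simp only [uq_mul_eq_sum_gradient (hq.differentiable (by simp)) (fun x => (hqpos x).ne') hk]
  rw [integral_finsetSum _ fun i _ => (happ (hv i).1 i).1]
  refine Finset.sum_eq_zero fun i _ => ?_
  rw [(happ (hv i).1 i).2, (hv i).2]
  rfl
end
end

section
/- Let p and q be smooth, everywhere positive probability densities on ℝ^d with scores s_p = ∇ log p and s_q = ∇ log q, and suppose each component s_q^ℓ of s_q is in the Stein class of p; assume ‖s_p‖²₂, ‖s_q‖²₂, s_pᵀ s_q and div s_q are all p-integrable. Then the Fisher divergence decomposes as F(p,q) = ∫ ( ‖s_q(x)‖²₂ + 2 · div_x s_q(x) ) p(x) dx + ∫ ‖s_p(x)‖²₂ p(x) dx, where F(p,q) = ∫ ‖s_q(x) − s_p(x)‖²₂ p(x) dx and div_x s_q(x) = tr(∇_x s_q(x)) = Σ_ℓ ∂ s_q^ℓ / ∂ x_ℓ is the Laplacian of log q. -/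
open MeasureTheory Real
open scoped RealInnerProductSpace

noncomputable section

/-- Divergence of a vector field `f : ℝ^d → ℝ^d` : `div f x = ∑ ℓ, ∂f_ℓ/∂x_ℓ`. -/
def diverg {d : ℕ} (f : Eu d → Eu d) (x : Eu d) : ℝ :=
  ∑ ℓ, fderiv ℝ (fun y => f y ℓ) x (EuclideanSpace.single ℓ 1)


lemma gradient_apply_eq_fderiv {d : ℕ} (f : Eu d → ℝ) (x : Eu d) (ℓ : Fin d) :
    gradient f x ℓ = fderiv ℝ f x (EuclideanSpace.single ℓ 1) := by
  have h : ⟪gradient f x, EuclideanSpace.single ℓ (1 : ℝ)⟫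
      = fderiv ℝ f x (EuclideanSpace.single ℓ 1) := by
    simp only [gradient, InnerProductSpace.toDual_symm_apply]
  rw [← h, EuclideanSpace.inner_single_right]
  simp

lemma score_apply_mul {d : ℕ} {p : Eu d → ℝ} {x : Eu d} (hp : DifferentiableAt ℝ p x)
    (hx : p x ≠ 0) (ℓ : Fin d) :
    score p x ℓ * p x = fderiv ℝ p x (EuclideanSpace.single ℓ 1) := by
  rw [score, gradient_apply_eq_fderiv, fderiv.log hp hx]
  simp only [smul_apply, smul_eq_mul]
  field_simp

lemma differentiable_score_apply {d : ℕ} {q : Eu d → ℝ} (hq : ContDiff ℝ 2 q)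
    (hq0 : ∀ x, q x ≠ 0) (ℓ : Fin d) : Differentiable ℝ fun x => score q x ℓ := by
  simp only [score, gradient_apply_eq_fderiv]
  have h : ContDiff ℝ 1 (fderiv ℝ fun y => Real.log (q y)) :=
    (hq.log hq0).fderiv_right (by norm_num)
  exact (h.differentiable (by norm_num)).clm_apply (differentiable_const _)

lemma sum_gradient_mul_apply {d : ℕ} {f : Eu d → Eu d} {p : Eu d → ℝ} {x : Eu d}
    (hf : ∀ ℓ, DifferentiableAt ℝ (fun y => f y ℓ) x) (hp : DifferentiableAt ℝ p x)
    (hx : p x ≠ 0) :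
    ∑ ℓ, gradient (fun y => f y ℓ * p y) x ℓ
      = diverg f x * p x + ⟪score p x, f x⟫ * p x := by
  rw [diverg, PiLp.inner_apply, Finset.sum_mul, Finset.sum_mul, ← Finset.sum_add_distrib]
  refine Finset.sum_congr rfl fun ℓ _ => ?_
  rw [gradient_apply_eq_fderiv, fderiv_fun_mul (hf ℓ) hp]
  simp only [add_apply, smul_apply, smul_eq_mul,
    ← score_apply_mul hp hx ℓ, RCLike.inner_apply, conj_trivial]
  ring

lemma SteinClass.integral_gradient_apply {d : ℕ} {p f : Eu d → ℝ} (h : SteinClass p f)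
    (ℓ : Fin d) :
    Integrable (fun x => gradient (fun y => f y * p y) x ℓ) ∧
      ∫ x, gradient (fun y => f y * p y) x ℓ = 0 := by
  refine ⟨(EuclideanSpace.proj ℓ : Eu d →L[ℝ] ℝ).integrable_comp h.1, ?_⟩
  have := (EuclideanSpace.proj ℓ : Eu d →L[ℝ] ℝ).integral_comp_comm h.1
  rw [h.2, map_zero] at this
  exact this

/-- **Decomposition of the Fisher divergence.** If the components of `s_q` are in the Stein
class of `p` and the relevant functions are `p`-integrable, then
`F(p,q) = ∫ (‖s_q‖² + 2 div s_q) p + ∫ ‖s_p‖² p`. -/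
theorem fisher_divergence_decomposition {d : ℕ} (p q : Eu d → ℝ)
    (hp : ContDiff ℝ (⊤ : ℕ∞) p) (hq : ContDiff ℝ (⊤ : ℕ∞) q)
    (hppos : ∀ x, 0 < p x) (hqpos : ∀ x, 0 < q x)
    (hpint : (∫ x, p x) = 1) (hqint : (∫ x, q x) = 1)
    (hstein : ∀ ℓ : Fin d, SteinClass p (fun x => score q x ℓ))
    (h1 : MeasureTheory.Integrable (fun x => ‖score p x‖ ^ 2 * p x))
    (h2 : MeasureTheory.Integrable (fun x => ‖score q x‖ ^ 2 * p x))
    (h3 : MeasureTheory.Integrable (fun x => ⟪score p x, score q x⟫ * p x))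
    (h4 : MeasureTheory.Integrable (fun x => diverg (score q) x * p x)) :
    (∫ x, ‖score q x - score p x‖ ^ 2 * p x)
      = (∫ x, (‖score q x‖ ^ 2 + 2 * diverg (score q) x) * p x)
        + ∫ x, ‖score p x‖ ^ 2 * p x := by
  have hstein_sum :
      (∫ x, diverg (score q) x * p x) + ∫ x, ⟪score p x, score q x⟫ * p x = 0 := by
    rw [← integral_add h4 h3]
    calc ∫ x, (diverg (score q) x * p x + ⟪score p x, score q x⟫ * p x)
        = ∫ x, ∑ ℓ, gradient (fun y => score q y ℓ * p y) x ℓ := by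
          refine integral_congr_ae (.of_forall fun x => ?_)
          exact (sum_gradient_mul_apply
            (fun ℓ => differentiable_score_apply (contDiff_infty.1 hq 2)
              (fun y => (hqpos y).ne') ℓ x)
            (hp.differentiable (by simp) x) (hppos x).ne').symm
      _ = 0 := by
          rw [integral_finsetSum _ fun ℓ _ => ((hstein ℓ).integral_gradient_apply ℓ).1]
          exact Finset.sum_eq_zero fun ℓ _ => ((hstein ℓ).integral_gradient_apply ℓ).2
  have hlhs : ∀ x, ‖score q x - score p x‖ ^ 2 * p x
      = ‖score q x‖ ^ 2 * p x - 2 * (⟪score p x, score q x⟫ * p x)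
        + ‖score p x‖ ^ 2 * p x := by
    intro x
    rw [norm_sub_sq_real, real_inner_comm]
    ring
  have hrhs : ∀ x, (‖score q x‖ ^ 2 + 2 * diverg (score q) x) * p x
      = ‖score q x‖ ^ 2 * p x + 2 * (diverg (score q) x * p x) := fun x => by ring
  simp only [hlhs, hrhs]
  have hsub : Integrable fun x =>
      ‖score q x‖ ^ 2 * p x - 2 * (⟪score p x, score q x⟫ * p x) := h2.sub (h3.const_mul 2)
  rw [integral_add hsub h1, integral_sub h2 (h3.const_mul 2),
    integral_add h2 (h4.const_mul 2), integral_const_mul, integral_const_mul]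
  linarith
end
end
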